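/- arXiv:1907.01769 — 2 statements merged into one kernel-verified Lean document; each statement's English description precedes it below -/
import Mathlib

section
/- Let C be a nonempty convex subset of ∂B₁, x̄ ∈ ri(C), s̄ = sign(D*x̄), and F̄ = B₁ ∩ {x ∈ ℝ^n : ⟨Ds̄, x⟩ = 1}. Then C ⊆ F̄ and ri(C) ⊆ ri(F̄). Moreover, F̄ is the smallest face of B₁ with ri(C) ∩ F̄ ≠ ∅ (i.e. every face F of B₁ with ri(C) ∩ F ≠ ∅ satisfies F̄ ⊆ F), and F̄ is the unique face F of B₁ with ri(C) ∩ ri(F) ≠ ∅. -/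
open Matrix Set

noncomputable section

/-- `Vec n` is `ℝ^n`. -/
abbrev Vec (n : ℕ) := Fin n → ℝ

/-- The ℓ¹-norm on `ℝ^p`. -/
def l1 {p : ℕ} (θ : Vec p) : ℝ := ∑ i, |θ i|

/-- The componentwise sign vector. -/
def sgn {p : ℕ} (θ : Vec p) : Vec p := fun i => Real.sign (θ i)

/-- `s` is a sign vector, i.e. `s ∈ {-1,0,1}^p`. -/
def IsSignVec {p : ℕ} (s : Vec p) : Prop := ∀ i, s i = -1 ∨ s i = 0 ∨ s i = 1

/-- The order `s ≼ s'` on sign vectors: `sᵢ ≠ 0 → s'ᵢ = sᵢ`. -/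
def sleq {p : ℕ} (s s' : Vec p) : Prop := ∀ i, s i ≠ 0 → s' i = s i

/-- The cosupport `{i : uᵢ = 0}`. -/
def cosupp {p : ℕ} (u : Vec p) : Set (Fin p) := {i | u i = 0}

/-- The analysis operator `D* x = Dᵀ x`. -/
def Dstar {n p : ℕ} (D : Matrix (Fin n) (Fin p) ℝ) (x : Vec n) : Vec p := Dᵀ *ᵥ x

/-- The ball `B_r = {x : ‖D*x‖₁ ≤ r}`. -/
def Ball {n p : ℕ} (D : Matrix (Fin n) (Fin p) ℝ) (r : ℝ) : Set (Vec n) :=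
  {x | l1 (Dstar D x) ≤ r}

/-- The sphere `∂B_r = {x : ‖D*x‖₁ = r}`. -/
def Sph {n p : ℕ} (D : Matrix (Fin n) (Fin p) ℝ) (r : ℝ) : Set (Vec n) :=
  {x | l1 (Dstar D x) = r}

/-- `Ker D*_J = {x : (D*x)ᵢ = 0 for all i ∈ J}`. -/
def kerDJ {n p : ℕ} (D : Matrix (Fin n) (Fin p) ℝ) (J : Set (Fin p)) : Set (Vec n) :=
  {x | ∀ i ∈ J, Dstar D x i = 0}

/-- The relative interior of a set. -/
def ri {n : ℕ} (C : Set (Vec n)) : Set (Vec n) := intrinsicInterior ℝ C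

/-- The direction of (the affine hull of) a set, as a set of vectors. -/
def dir {n : ℕ} (C : Set (Vec n)) : Set (Vec n) := ((affineSpan ℝ C).direction : Set (Vec n))

/-- `F` is an exposed face of `X`: the intersection of `X` with a supporting hyperplane. -/
def IsExposedFace {n : ℕ} (X F : Set (Vec n)) : Prop :=
  ∃ (α : Vec n) (β : ℝ), α ≠ 0 ∧ (∀ x ∈ X, α ⬝ᵥ x ≤ β) ∧ F = X ∩ {x | α ⬝ᵥ x = β}

/-- `G` is a face of `X`: a convex extreme subset of `X`. -/
def IsFace {n : ℕ} (X G : Set (Vec n)) : Prop := Convex ℝ G ∧ IsExtreme ℝ X G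

/-- `x` is an extreme point of `C`: it is not the midpoint of two distinct points of `C`. -/
def IsExtremePt {n : ℕ} (C : Set (Vec n)) (x : Vec n) : Prop :=
  x ∈ C ∧ ∀ x₁ ∈ C, ∀ x₂ ∈ C, x = midpoint ℝ x₁ x₂ → x₁ = x₂

/-- The objective `L(x) = (1/2)‖y − Φx‖₂² + λ‖D*x‖₁`. -/
def Lfun {n p q : ℕ} (D : Matrix (Fin n) (Fin p) ℝ) (Phi : Matrix (Fin q) (Fin n) ℝ)
    (y : Vec q) (lam : ℝ) (x : Vec n) : ℝ :=
  (1/2 : ℝ) * ((y - Phi *ᵥ x) ⬝ᵥ (y - Phi *ᵥ x)) + lam * l1 (Dstar D x)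

lemma ri_ext {n : ℕ} {C : Set (Vec n)} {x y : Vec n} (hx : x ∈ ri C) (hy : y ∈ C) :
    ∃ ε : ℝ, 0 < ε ∧ x + ε • (x - y) ∈ C := by
  obtain ⟨z, hz, rfl⟩ := mem_intrinsicInterior.1 hx
  have hyA : y ∈ affineSpan ℝ C := subset_affineSpan ℝ C hy
  have hmem : ∀ t : ℝ, (z : Vec n) + t • ((z : Vec n) - y) ∈ affineSpan ℝ C := by
    intro t
    have := AffineMap.lineMap_mem (-t) z.2 hyA
    convert this using 1
    simp [AffineMap.lineMap_apply]
    module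
  let f : ℝ → affineSpan ℝ C := fun t => ⟨(z : Vec n) + t • ((z : Vec n) - y), hmem t⟩
  have hf : Continuous f := by
    apply Continuous.subtype_mk
    fun_prop
  have hf0 : f 0 = z := by
    apply Subtype.ext
    simp [f]
  have h1 : f ⁻¹' (interior ((↑) ⁻¹' C)) ∈ nhds (0 : ℝ) := by
    apply (isOpen_interior.preimage hf).mem_nhds
    simpa [hf0] using hz
  obtain ⟨ε, hε, hb⟩ := Metric.mem_nhds_iff.1 h1
  refine ⟨ε / 2, by positivity, ?_⟩
  have h2 : (ε / 2) ∈ Metric.ball (0 : ℝ) ε := by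
    rw [Metric.mem_ball, Real.dist_eq, sub_zero, abs_of_pos (by positivity)]
    linarith
  have h3 : f (ε / 2) ∈ ((↑) ⁻¹' C : Set (affineSpan ℝ C)) := interior_subset (hb h2)
  exact h3

lemma face_of_ri {n : ℕ} {X A F : Set (Vec n)} {x : Vec n} (hx : x ∈ ri A) (hA : A ⊆ X)
    (hF : IsFace X F) (hxF : x ∈ F) : A ⊆ F := by
  intro y hy
  obtain ⟨ε, hε, hz⟩ := ri_ext hx hy
  refine hF.2.left_mem_of_mem_openSegment (hA hy) (hA hz) hxF ?_
  refine ⟨ε / (1 + ε), 1 / (1 + ε), by positivity, by positivity, by field_simp; ring, ?_⟩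
  ext i
  simp
  field_simp
  ring

lemma dot_eq {n p : ℕ} (D : Matrix (Fin n) (Fin p) ℝ) (s : Vec p) (x : Vec n) :
    (D *ᵥ s) ⬝ᵥ x = ∑ i, s i * Dstar D x i := by
  have : (D *ᵥ s) ⬝ᵥ x = s ⬝ᵥ (Dᵀ *ᵥ x) := by
    rw [dotProduct_comm, dotProduct_mulVec, mulVec_transpose, dotProduct_comm]
  rw [this]; rfl

lemma sign_mul_le (a b : ℝ) : Real.sign a * b ≤ |b| := by
  rcases Real.sign_apply_eq a with h | h | h <;> rw [h]
  · simpa using neg_le_abs b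
  · simp
  · simpa using le_abs_self b

lemma sign_mul_self' (a : ℝ) : Real.sign a * a = |a| := by
  rcases lt_trichotomy a 0 with h | h | h
  · simp [Real.sign_of_neg h, abs_of_neg h]
  · simp [h]
  · simp [Real.sign_of_pos h, abs_of_pos h]

/-- The face attached to `x`. -/
def FF {n p : ℕ} (D : Matrix (Fin n) (Fin p) ℝ) (x : Vec n) : Set (Vec n) :=
  Ball D 1 ∩ {y | (D *ᵥ sgn (Dstar D x)) ⬝ᵥ y = 1}

lemma dot_le {n p : ℕ} (D : Matrix (Fin n) (Fin p) ℝ) (x y : Vec n) :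
    (D *ᵥ sgn (Dstar D x)) ⬝ᵥ y ≤ l1 (Dstar D y) := by
  rw [dot_eq]
  exact Finset.sum_le_sum fun i _ => sign_mul_le _ _

lemma Dstar_comb {n p : ℕ} (D : Matrix (Fin n) (Fin p) ℝ) (x y : Vec n) (a b : ℝ) :
    Dstar D (a • x + b • y) = a • Dstar D x + b • Dstar D y := by
  simp [Dstar, mulVec_add, mulVec_smul]

lemma convex_ball' {n p : ℕ} (D : Matrix (Fin n) (Fin p) ℝ) : Convex ℝ (Ball D 1) := by
  intro x hx y hy a b ha hb hab
  simp only [Ball, mem_setOf_eq] at *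
  have : l1 (Dstar D (a • x + b • y)) ≤ a * l1 (Dstar D x) + b * l1 (Dstar D y) := by
    rw [Dstar_comb, l1, l1, l1, Finset.mul_sum, Finset.mul_sum, ← Finset.sum_add_distrib]
    refine Finset.sum_le_sum fun i _ => ?_
    refine (abs_add_le _ _).trans (le_of_eq ?_)
    simp [abs_mul, abs_of_nonneg ha, abs_of_nonneg hb]
  nlinarith

lemma face_FF {n p : ℕ} (D : Matrix (Fin n) (Fin p) ℝ) (x : Vec n) :
    IsFace (Ball D 1) (FF D x) := by
  constructor
  · refine (convex_ball' D).inter ?_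
    intro u hu v hv a b ha hb hab
    simp only [mem_setOf_eq, dotProduct_add, dotProduct_smul, smul_eq_mul] at *
    rw [hu, hv]; linarith
  · refine ⟨inter_subset_left, ?_⟩
    rintro u hu v hv w hw ⟨a, b, ha, hb, hab, rfl⟩
    refine ⟨hu, ?_⟩
    have h1 := (dot_le D x u).trans hu
    have h2 := (dot_le D x v).trans hv
    have h3 := hw.2
    simp only [mem_setOf_eq, dotProduct_add, dotProduct_smul, smul_eq_mul] at *
    by_contra hne
    have h4 := lt_of_le_of_ne h1 hne
    nlinarith

lemma sub_ri_FF {n p : ℕ} (D : Matrix (Fin n) (Fin p) ℝ) (x : Vec n) (hx : x ∈ Sph D 1) :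
    x ∈ ri (FF D x) := by
  have hxF : x ∈ FF D x := by
    refine ⟨le_of_eq hx, ?_⟩
    have : l1 (Dstar D x) = 1 := hx
    rw [mem_setOf_eq, dot_eq, ← this]
    exact Finset.sum_congr rfl fun i _ => sign_mul_self' _
  have hspan : ∀ z ∈ affineSpan ℝ (FF D x), (D *ᵥ sgn (Dstar D x)) ⬝ᵥ z = 1 ∧
      ∀ i, Dstar D x i = 0 → Dstar D z i = 0 := by
    intro z hz
    refine affineSpan_induction (p := fun z => (D *ᵥ sgn (Dstar D x)) ⬝ᵥ z = 1 ∧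
      ∀ i, Dstar D x i = 0 → Dstar D z i = 0) hz ?_ ?_
    · intro y hy
      refine ⟨hy.2, ?_⟩
      have h1 : l1 (Dstar D y) ≤ 1 := hy.1
      have h2 : (D *ᵥ sgn (Dstar D x)) ⬝ᵥ y = 1 := hy.2
      have h3 := dot_le D x y
      rw [dot_eq] at h2 h3
      have h4 := (Finset.sum_eq_sum_iff_of_le
        (fun i _ => sign_mul_le (Dstar D x i) (Dstar D y i))).1
        (le_antisymm h3 (h1.trans h2.ge))
      intro i hi
      have := h4 i (Finset.mem_univ i)
      rw [hi, Real.sign_zero, zero_mul] at this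
      exact abs_eq_zero.1 this.symm
    · intro c u v w hu hv hw
      have hD : Dstar D (c • (u -ᵥ v) +ᵥ w)
          = c • (Dstar D u - Dstar D v) + Dstar D w := by
        simp [Dstar, mulVec_add, mulVec_smul, mulVec_sub]
      constructor
      · simp [dotProduct_add, dotProduct_smul, dotProduct_sub, hu.1, hv.1, hw.1]
      · intro i hi
        rw [hD]
        simp [hu.2 i hi, hv.2 i hi, hw.2 i hi]
  refine mem_intrinsicInterior.2 ⟨⟨x, subset_affineSpan ℝ _ hxF⟩, ?_, rfl⟩
  have hcont : ∀ i, Continuous fun z : affineSpan ℝ (FF D x) => Dstar D (z : Vec n) i := by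
    intro i
    have : Continuous fun z : Vec n => Dstar D z i := by
      unfold Dstar mulVec dotProduct
      fun_prop
    exact this.comp continuous_subtype_val
  let U : Set (affineSpan ℝ (FF D x)) :=
    ⋂ i, {z | Dstar D x i ≠ 0 → 0 < Real.sign (Dstar D x i) * Dstar D (z : Vec n) i}
  have hU : IsOpen U := by
    refine isOpen_iInter_of_finite fun i => ?_
    by_cases h : Dstar D x i = 0
    · simp [h]
    · simp only [ne_eq, h, not_false_eq_true, true_imp_iff]
      exact isOpen_lt continuous_const (continuous_const.mul (hcont i))
  refine mem_interior.2 ⟨U, ?_, hU, ?_⟩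
  · intro z hz
    obtain ⟨h1, h2⟩ := hspan z z.2
    refine ⟨?_, h1⟩
    have : l1 (Dstar D (z : Vec n)) = 1 := by
      rw [← h1, dot_eq]
      refine Finset.sum_congr rfl fun i _ => ?_
      by_cases h : Dstar D x i = 0
      · simp [h2 i h]
      · have h3 := mem_iInter.1 hz i h
        show _ = Real.sign _ * _
        rcases Real.sign_apply_eq_of_ne_zero _ h with h5 | h5 <;> rw [h5] at h3 ⊢
        · rw [abs_of_neg (by linarith)]; ring
        · rw [abs_of_pos (by linarith)]; ring
    exact this.le
  · refine mem_iInter.2 fun i h => ?_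
    show 0 < Real.sign _ * _
    rw [sign_mul_self']
    exact abs_pos.2 h

/-- for a nonempty convex `C ⊆ ∂B₁`, `x̄ ∈ ri(C)`, `s̄ = sign(D*x̄)` and
`F̄ = B₁ ∩ {x : ⟨Ds̄, x⟩ = 1}`, one has `C ⊆ F̄`, `ri(C) ⊆ ri(F̄)`, and `F̄` is the smallest face of
`B₁` meeting `ri(C)`, and the unique face whose relative interior meets `ri(C)`. -/
theorem stmt_5 {n p : ℕ} (hn : 0 < n) (hp : 0 < p) (D : Matrix (Fin n) (Fin p) ℝ)
    (C : Set (Vec n)) (hCne : C.Nonempty) (hCc : Convex ℝ C) (hCsub : C ⊆ Sph D 1)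
    (xb : Vec n) (hxb : xb ∈ ri C)
    (sb : Vec p) (hsb : sb = sgn (Dstar D xb))
    (Fb : Set (Vec n)) (hFb : Fb = Ball D 1 ∩ {x | (D *ᵥ sb) ⬝ᵥ x = 1}) :
    C ⊆ Fb ∧ ri C ⊆ ri Fb ∧
    IsFace (Ball D 1) Fb ∧ (ri C ∩ Fb).Nonempty ∧
    (∀ F : Set (Vec n), IsFace (Ball D 1) F → (ri C ∩ F).Nonempty → Fb ⊆ F) ∧
    (∀ F : Set (Vec n), IsFace (Ball D 1) F → (ri C ∩ ri F).Nonempty → F = Fb) := by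
  have hF : Fb = FF D xb := by rw [hFb, hsb]; rfl
  have hCB : C ⊆ Ball D 1 := fun y hy => le_of_eq (hCsub hy)
  have hin : ∀ x ∈ ri C, x ∈ C := fun x hx => intrinsicInterior_subset hx
  have hri : ∀ x ∈ ri C, x ∈ ri (FF D x) := fun x hx => sub_ri_FF D x (hCsub (hin x hx))
  have hCF : ∀ x ∈ ri C, C ⊆ FF D x := fun x hx =>
    face_of_ri hx hCB (face_FF D x) (intrinsicInterior_subset (hri x hx))
  have hle : ∀ x ∈ ri C, ∀ y ∈ ri C, FF D x ⊆ FF D y := fun x hx y hy =>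
    face_of_ri (hri x hx) inter_subset_left (face_FF D y) (hCF y hy (hin x hx))
  have hsub : ri C ⊆ ri (FF D xb) := by
    intro x hx
    rw [(hle xb hxb x hx).antisymm (hle x hx xb hxb)]
    exact hri x hx
  have h5 : ∀ F : Set (Vec n), IsFace (Ball D 1) F → (ri C ∩ F).Nonempty → FF D xb ⊆ F := by
    rintro F hFf ⟨x, hx, hxF⟩
    exact face_of_ri (hsub hx) inter_subset_left hFf hxF
  rw [hF]
  refine ⟨hCF xb hxb, hsub, face_FF D xb, ⟨xb, hxb, hCF xb hxb (hin xb hxb)⟩, h5, ?_⟩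
  rintro F hFf ⟨x, hx, hxF⟩
  refine Subset.antisymm ?_ (h5 F hFf ⟨x, hx, intrinsicInterior_subset hxF⟩)
  exact face_of_ri hxF hFf.2.1 (face_FF D xb) (hCF xb hxb (hin x hx))
end
end

section
/- Let A be an affine subspace of ℝ^n intersecting ∂B₁, x̄ ∈ A ∩ ∂B₁, s̄ = sign(D*x̄), J̄ = cosupp(D*x̄). Then x̄ is an extreme point of A ∩ B₁ if and only if dir(A) ∩ (Ds̄)⊥ ∩ Ker D*_J̄ = {0}; and in the case A ∩ B₁ ⊆ ∂B₁, this is further equivalent to dir(A) ∩ Ker D*_J̄ = {0}. Moreover, A ∩ B₁ admits an extreme point if and only if A ∩ B₁ is compact, if and only if dir(A) ∩ Ker D* = {0}; and every extreme point of A ∩ B₁ belongs to A ∩ ∂B₁. -/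
open Matrix Set

noncomputable section

theorem aux_abs (u v : ℝ) (h : |v| ≤ |u|) : |u + v| = |u| + Real.sign u * v := by
  rcases lt_trichotomy u 0 with hu | hu | hu
  · rw [Real.sign_of_neg hu, abs_of_neg hu]
    rw [abs_of_neg hu] at h
    have := abs_le.1 h
    rw [abs_of_nonpos (by linarith)]; ring
  · subst hu
    simp at h
    simp [h]
  · rw [Real.sign_of_pos hu, abs_of_pos hu]
    rw [abs_of_pos hu] at h
    have := abs_le.1 h
    rw [abs_of_nonneg (by linarith)]; ring

theorem aux_two (u v : ℝ) : 2 * |u| ≤ |u + v| + |u - v| := by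
  have h := abs_add_le (u + v) (u - v)
  have e : u + v + (u - v) = 2 * u := by ring
  rw [e, abs_mul] at h
  simpa using h

theorem aux_two' (u v : ℝ) (h : |u + v| + |u - v| = 2 * |u|) : |v| ≤ |u| := by
  have h' := abs_sub (u + v) (u - v)
  have e : u + v - (u - v) = 2 * v := by ring
  rw [e, abs_mul, h] at h'
  simpa using h'

theorem aux_eps {p : ℕ} (u v : Vec p) (h : ∀ i, u i = 0 → v i = 0) :
    ∃ ε : ℝ, 0 < ε ∧ ∀ i, |ε * v i| ≤ |u i| := by
  have H : ∀ᶠ ε in nhdsWithin (0 : ℝ) (Set.Ioi 0), ∀ i, |ε * v i| ≤ |u i| := by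
    rw [Filter.eventually_all]
    intro i
    by_cases hu : u i = 0
    · simp [hu, h i hu]
    · have hc : Continuous (fun ε : ℝ => |ε * v i|) := by fun_prop
      have := hc.tendsto 0
      have h2 := this.eventually_le_const (u := |u i|) (by simpa using hu)
      exact h2.filter_mono nhdsWithin_le_nhds
  obtain ⟨ε, h1, h2⟩ := (H.and self_mem_nhdsWithin).exists
  exact ⟨ε, h2, h1⟩

theorem aux_l1 {p : ℕ} (u v : Vec p) (h : ∀ i, |v i| ≤ |u i|) :
    l1 (u + v) = l1 u + sgn u ⬝ᵥ v := by
  simp only [l1, sgn, dotProduct, ← Finset.sum_add_distrib, Pi.add_apply]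
  exact Finset.sum_congr rfl fun i _ => aux_abs _ _ (h i)

theorem aux_dot {n p : ℕ} (D : Matrix (Fin n) (Fin p) ℝ) (s : Vec p) (d : Vec n) :
    (D *ᵥ s) ⬝ᵥ d = s ⬝ᵥ Dstar D d := by
  rw [Dstar, Matrix.dotProduct_mulVec, Matrix.vecMul_transpose]

theorem aux_Dadd {n p : ℕ} (D : Matrix (Fin n) (Fin p) ℝ) (x y : Vec n) :
    Dstar D (x + y) = Dstar D x + Dstar D y := Matrix.mulVec_add _ _ _

theorem aux_Dsub {n p : ℕ} (D : Matrix (Fin n) (Fin p) ℝ) (x y : Vec n) :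
    Dstar D (x - y) = Dstar D x - Dstar D y := Matrix.mulVec_sub _ _ _

theorem aux_Dsmul {n p : ℕ} (D : Matrix (Fin n) (Fin p) ℝ) (c : ℝ) (y : Vec n) :
    Dstar D (c • y) = c • Dstar D y := Matrix.mulVec_smul _ _ _

theorem aux_cont {n p : ℕ} (D : Matrix (Fin n) (Fin p) ℝ) :
    Continuous (fun x => l1 (Dstar D x)) := by
  unfold l1 Dstar
  have : Continuous (fun x : Vec n => Dᵀ *ᵥ x) := (Matrix.mulVecLin Dᵀ).continuous_of_finiteDimensional
  fun_prop

/-- symmetric perturbations -/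
theorem aux_sym {n : ℕ} {C : Set (Vec n)} {x d : Vec n} (h : IsExtremePt C x)
    (h1 : x + d ∈ C) (h2 : x - d ∈ C) : d = 0 := by
  have := h.2 _ h1 _ h2 (by simp)
  have h3 : (2 : ℝ) • d = 0 := by
    rw [two_smul]
    have : x + d - (x - d) = 0 := sub_eq_zero.2 this
    rw [← this]; abel
  simpa using h3

theorem aux_add {n : ℕ} {A : AffineSubspace ℝ (Vec n)} {x d : Vec n} (hx : x ∈ A)
    (hd : d ∈ A.direction) : x + d ∈ A := by
  rw [add_comm]; exact AffineSubspace.vadd_mem_of_mem_direction hd hx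

theorem aux_sub {n : ℕ} {A : AffineSubspace ℝ (Vec n)} {x d : Vec n} (hx : x ∈ A)
    (hd : d ∈ A.direction) : x - d ∈ A := by
  rw [sub_eq_add_neg]; exact aux_add hx (A.direction.neg_mem hd)

theorem aux_move {n p : ℕ} (D : Matrix (Fin n) (Fin p) ℝ) (x d : Vec n)
    (h : d ∈ kerDJ D (cosupp (Dstar D x))) :
    ∃ ε : ℝ, 0 < ε ∧
      l1 (Dstar D (x + ε • d)) = l1 (Dstar D x) + ε * ((D *ᵥ sgn (Dstar D x)) ⬝ᵥ d) ∧
      l1 (Dstar D (x - ε • d)) = l1 (Dstar D x) - ε * ((D *ᵥ sgn (Dstar D x)) ⬝ᵥ d) := by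
  obtain ⟨ε, h0, hε⟩ := aux_eps (Dstar D x) (Dstar D d) (fun i hi => h i hi)
  refine ⟨ε, h0, ?_, ?_⟩
  · rw [aux_Dadd, aux_Dsmul, aux_l1 _ _ (by simpa using hε), aux_dot, dotProduct_smul, smul_eq_mul]
  · rw [aux_Dsub, aux_Dsmul, sub_eq_add_neg, aux_l1 _ _ (by simpa using hε), aux_dot,
      dotProduct_neg, dotProduct_smul, smul_eq_mul, sub_eq_add_neg]

theorem aux_set {n : ℕ} {S : Set (Vec n)} (h0 : (0 : Vec n) ∈ S) :
    S = {0} ↔ ∀ d ∈ S, d = 0 := by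
  constructor
  · intro h d hd; rw [h] at hd; exact hd
  · intro h; ext d; exact ⟨fun hd => h d hd, fun hd => by rw [mem_singleton_iff.1 hd]; exact h0⟩

theorem aux_part1 {n p : ℕ} (D : Matrix (Fin n) (Fin p) ℝ)
    (A : AffineSubspace ℝ (Vec n)) (x : Vec n) (hA : x ∈ A) (hS : x ∈ Sph D 1) :
    IsExtremePt ((A : Set (Vec n)) ∩ Ball D 1) x ↔
      ∀ d ∈ A.direction, (D *ᵥ sgn (Dstar D x)) ⬝ᵥ d = 0 →
        d ∈ kerDJ D (cosupp (Dstar D x)) → d = 0 := by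
  have hS' : l1 (Dstar D x) = 1 := hS
  constructor
  · intro h d hd h1 h2
    obtain ⟨ε, h0, ha, hb⟩ := aux_move D x d h2
    have hd' := A.direction.smul_mem ε hd
    rw [h1, hS'] at ha hb
    have := aux_sym h ⟨aux_add hA hd', by simp [Ball, ha]⟩ ⟨aux_sub hA hd', by simp [Ball, hb]⟩
    simpa [h0.ne'] using this
  · intro h
    refine ⟨⟨hA, hS'.le⟩, ?_⟩
    rintro x₁ ⟨h1A, h1B⟩ x₂ ⟨h2A, h2B⟩ hm
    obtain ⟨d, rfl⟩ : ∃ d, x₁ = x + d := ⟨x₁ - x, by abel⟩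
    have hx2 : x₂ = x - d := by
      have : (2 : ℝ) • x = x + d + x₂ := by
        conv_lhs => rw [hm]
        rw [midpoint_eq_smul_add, smul_smul]; simp
      rw [two_smul] at this
      have h3 : x = d + x₂ := by
        apply add_left_cancel (a := x); rw [this]; abel
      conv_rhs => rw [h3]
      abel
    subst hx2
    have hd : d ∈ A.direction := by
      have := AffineSubspace.vsub_mem_direction h1A hA
      simpa using this
    have e1 : l1 (Dstar D x + Dstar D d) ≤ 1 := by rw [← aux_Dadd]; exact h1B
    have e2 : l1 (Dstar D x - Dstar D d) ≤ 1 := by rw [← aux_Dsub]; exact h2B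
    have hterm : ∀ i, |Dstar D x i + Dstar D d i| + |Dstar D x i - Dstar D d i|
        = 2 * |Dstar D x i| := by
      have hs : ∑ i, 2 * |Dstar D x i| =
          ∑ i, (|Dstar D x i + Dstar D d i| + |Dstar D x i - Dstar D d i|) := by
        apply le_antisymm (Finset.sum_le_sum fun i _ => aux_two _ _)
        rw [Finset.sum_add_distrib, ← Finset.mul_sum]
        simp only [l1, Pi.add_apply, Pi.sub_apply] at e1 e2 hS'
        linarith
      have := (Finset.sum_eq_sum_iff_of_le (fun i _ => aux_two _ _)).1 hs
      exact fun i => (this i (Finset.mem_univ i)).symm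
    have hle : ∀ i, |Dstar D d i| ≤ |Dstar D x i| := fun i => aux_two' _ _ (hterm i)
    have f1 := aux_l1 _ _ hle
    have f2 := aux_l1 (Dstar D x) (-Dstar D d) (by simpa using hle)
    rw [← sub_eq_add_neg, dotProduct_neg] at f2
    have : d = 0 := by
      apply h d hd
      · rw [aux_dot]; linarith
      · intro i hi
        have hi' : Dstar D x i = 0 := hi
        have := hle i
        rw [hi'] at this
        simpa using this
    simp [this]

theorem aux_convex {n p : ℕ} (D : Matrix (Fin n) (Fin p) ℝ)
    (A : AffineSubspace ℝ (Vec n))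
    (h : ∀ d ∈ A.direction, Dstar D d = 0 → d = 0) (x : Vec n) (hA : x ∈ A) :
    IsCompact ((A : Set (Vec n)) ∩ Ball D 1) := by
  have hcl : IsClosed ((A : Set (Vec n)) ∩ Ball D 1) := by
    apply IsClosed.inter
    · exact A.closed_of_finiteDimensional
    · exact isClosed_le (aux_cont D) continuous_const
  refine Metric.isCompact_of_isClosed_isBounded hcl ?_
  let f : A.direction →ₗ[ℝ] Vec p := (Matrix.mulVecLin Dᵀ).comp A.direction.subtype
  have hf : LinearMap.ker f = ⊥ := by
    rw [LinearMap.ker_eq_bot']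
    intro d hd
    exact Subtype.ext (h d d.2 hd)
  obtain ⟨K, -, hK⟩ := f.exists_antilipschitzWith hf
  rw [isBounded_iff_forall_norm_le]
  refine ⟨K * (1 + ‖Dstar D x‖) + ‖x‖, ?_⟩
  rintro y ⟨hyA, hyB⟩
  have hd : y - x ∈ A.direction := AffineSubspace.vsub_mem_direction hyA hA
  have h1 := hK.le_mul_dist ⟨y - x, hd⟩ 0
  rw [map_zero, dist_zero_right, dist_zero_right] at h1
  have h2 : f ⟨y - x, hd⟩ = Dstar D y - Dstar D x := aux_Dsub D y x
  have h3 : ‖y - x‖ ≤ K * ‖Dstar D y - Dstar D x‖ := by rw [← h2]; exact h1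
  have h4 : ‖Dstar D y‖ ≤ 1 := by
    rw [pi_norm_le_iff_of_nonneg zero_le_one]
    intro i
    refine le_trans ?_ hyB
    exact Finset.single_le_sum (f := fun i => |Dstar D y i|) (fun i _ => abs_nonneg _)
      (Finset.mem_univ i)
  have h5 := norm_sub_le (Dstar D y) (Dstar D x)
  have h6 : K * ‖Dstar D y - Dstar D x‖ ≤ K * (1 + ‖Dstar D x‖) :=
    mul_le_mul_of_nonneg_left (by linarith) K.2
  have h7 := norm_sub_norm_le y x
  linarith

/-- extremality in `A ∩ B₁` for an affine subspace `A` meeting `∂B₁`: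
`x̄ ∈ A ∩ ∂B₁` is extreme iff `dir(A) ∩ (Ds̄)⊥ ∩ Ker D*_J̄ = {0}` (and iff
`dir(A) ∩ Ker D*_J̄ = {0}` when `A ∩ B₁ ⊆ ∂B₁`); moreover `A ∩ B₁` admits extreme points iff it is
compact iff `dir(A) ∩ Ker D* = {0}`, and extreme points belong to `A ∩ ∂B₁`. -/
theorem stmt_11 {n p : ℕ} (hn : 0 < n) (hp : 0 < p) (D : Matrix (Fin n) (Fin p) ℝ)
    (A : AffineSubspace ℝ (Vec n))
    (hA : ((A : Set (Vec n)) ∩ Sph D 1).Nonempty)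
    (xb : Vec n) (hxbA : xb ∈ A) (hxbS : xb ∈ Sph D 1)
    (sb : Vec p) (hsb : sb = sgn (Dstar D xb))
    (Jb : Set (Fin p)) (hJb : Jb = cosupp (Dstar D xb)) :
    (IsExtremePt ((A : Set (Vec n)) ∩ Ball D 1) xb ↔
      (A.direction : Set (Vec n)) ∩ {d : Vec n | (D *ᵥ sb) ⬝ᵥ d = 0} ∩ kerDJ D Jb = {0}) ∧
    ((A : Set (Vec n)) ∩ Ball D 1 ⊆ Sph D 1 →
      (IsExtremePt ((A : Set (Vec n)) ∩ Ball D 1) xb ↔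
        (A.direction : Set (Vec n)) ∩ kerDJ D Jb = {0})) ∧
    ((∃ z, IsExtremePt ((A : Set (Vec n)) ∩ Ball D 1) z) ↔
      IsCompact ((A : Set (Vec n)) ∩ Ball D 1)) ∧
    ((∃ z, IsExtremePt ((A : Set (Vec n)) ∩ Ball D 1) z) ↔
      (A.direction : Set (Vec n)) ∩ {x : Vec n | Dstar D x = 0} = {0}) ∧
    (∀ z, IsExtremePt ((A : Set (Vec n)) ∩ Ball D 1) z → z ∈ (A : Set (Vec n)) ∩ Sph D 1) := by
  subst hsb hJb
  have hS' : l1 (Dstar D xb) = 1 := hxbS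
  have hz : Dstar D 0 = 0 := Matrix.mulVec_zero _
  have hk0 : (0 : Vec n) ∈ kerDJ D (cosupp (Dstar D xb)) := by
    intro i _; rw [hz]; rfl
  have hd0 : (0 : Vec n) ∈ (A.direction : Set (Vec n)) := A.direction.zero_mem
  have P1 := aux_part1 D A xb hxbA hxbS
  have Pa : (∃ z, IsExtremePt ((A : Set (Vec n)) ∩ Ball D 1) z) →
      ∀ d ∈ A.direction, Dstar D d = 0 → d = 0 := by
    rintro ⟨z, hz⟩ d hd hk
    refine aux_sym hz ⟨aux_add hz.1.1 hd, ?_⟩ ⟨aux_sub hz.1.1 hd, ?_⟩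
    · have := hz.1.2
      simpa [Ball, aux_Dadd, hk] using this
    · have := hz.1.2
      simpa [Ball, aux_Dsub, hk] using this
  have Pb := fun h => aux_convex D A h xb hxbA
  have Pc : IsCompact ((A : Set (Vec n)) ∩ Ball D 1) →
      ∃ z, IsExtremePt ((A : Set (Vec n)) ∩ Ball D 1) z := by
    intro hc
    obtain ⟨z, hz⟩ := hc.extremePoints_nonempty ⟨xb, hxbA, hS'.le⟩
    refine ⟨z, hz.1, ?_⟩
    intro x₁ h1 x₂ h2 hm
    by_contra hne
    have hop : z ∈ openSegment ℝ x₁ x₂ := by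
      rw [hm, midpoint_eq_smul_add]
      exact ⟨1/2, 1/2, by norm_num, by norm_num, by norm_num, by simp [smul_add]⟩
    have ha : x₁ = z := hz.2 h1 h2 hop
    have hb : x₂ = z := hz.2 h2 h1 (by rwa [openSegment_symm])
    exact hne (ha.trans hb.symm)
  refine ⟨?_, ?_, ⟨fun h => Pb (Pa h), Pc⟩, ?_, ?_⟩
  · rw [P1, aux_set (Set.mem_inter (Set.mem_inter hd0 (show (0 : Vec n) ∈ {d : Vec n | (D *ᵥ sgn (Dstar D xb)) ⬝ᵥ d = 0} by simp)) hk0)]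
    exact ⟨fun h d hd => h d hd.1.1 hd.1.2 hd.2, fun h d h1 h2 h3 => h d ⟨⟨h1, h2⟩, h3⟩⟩
  · intro hsub
    rw [P1, aux_set (Set.mem_inter hd0 hk0)]
    refine ⟨fun h d hd => h d hd.1 ?_ hd.2, fun h d h1 _ h3 => h d ⟨h1, h3⟩⟩
    obtain ⟨ε, h0, ha, hb⟩ := aux_move D xb d hd.2
    have hd' := A.direction.smul_mem ε hd.1
    rw [hS'] at ha hb
    have hm : ε * ((D *ᵥ sgn (Dstar D xb)) ⬝ᵥ d) = 0 := by
      rcases le_total (ε * ((D *ᵥ sgn (Dstar D xb)) ⬝ᵥ d)) 0 with hc | hc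
      · have hB : xb + ε • d ∈ Ball D 1 := by
          change l1 _ ≤ 1
          linarith
        have : l1 (Dstar D (xb + ε • d)) = 1 := hsub (Set.mem_inter (aux_add hxbA hd') hB)
        linarith
      · have hB : xb - ε • d ∈ Ball D 1 := by
          change l1 _ ≤ 1
          linarith
        have : l1 (Dstar D (xb - ε • d)) = 1 := hsub (Set.mem_inter (aux_sub hxbA hd') hB)
        linarith
    exact (mul_eq_zero.1 hm).resolve_left h0.ne'
  · rw [aux_set (Set.mem_inter hd0 (show (0 : Vec n) ∈ {x : Vec n | Dstar D x = 0} from hz))]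
    exact ⟨fun h d hd => Pa h d hd.1 hd.2, fun h => Pc (Pb fun d h1 h2 => h d ⟨h1, h2⟩)⟩
  · intro z hzE
    refine ⟨hzE.1.1, ?_⟩
    by_contra hne
    have hlt : l1 (Dstar D z) < 1 := lt_of_le_of_ne hzE.1.2 hne
    have hd : xb - z ∈ A.direction := AffineSubspace.vsub_mem_direction hxbA hzE.1.1
    have hc1 : Continuous (fun ε : ℝ => l1 (Dstar D (z + ε • (xb - z)))) :=
      (aux_cont D).comp (by fun_prop)
    have hc2 : Continuous (fun ε : ℝ => l1 (Dstar D (z - ε • (xb - z)))) :=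
      (aux_cont D).comp (by fun_prop)
    have e1 := (hc1.tendsto 0).eventually_le_const (u := 1) (by simpa using hlt)
    have e2 := (hc2.tendsto 0).eventually_le_const (u := 1) (by simpa using hlt)
    have e3 := (e1.and e2).filter_mono (nhdsWithin_le_nhds (s := Set.Ioi 0))
    obtain ⟨ε, ⟨h1, h2⟩, h3⟩ := (e3.and self_mem_nhdsWithin).exists
    have h3' : (0 : ℝ) < ε := h3
    have hd' := A.direction.smul_mem ε hd
    have h0 := aux_sym hzE ⟨aux_add hzE.1.1 hd', h1⟩ ⟨aux_sub hzE.1.1 hd', h2⟩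
    have h4 : xb - z = 0 := (smul_eq_zero.1 h0).resolve_left h3'.ne'
    have h5 : xb = z := sub_eq_zero.1 h4
    rw [h5] at hS'
    exact hne hS'
end
end
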